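/- Let m ≥ 1, N > 2m, and 1 < q < N/(2m). There exists a constant C = C(m, N, q) > 0 such that for every measurable function V : ℝᴺ → ℝ with finite weak L^{N/(2m)} quasinorm and every f ∈ C_c^∞(ℝᴺ; ℂ), ‖V f‖_{L^q(ℝᴺ)} ≤ C ‖V‖_{L^{N/(2m),∞}} ‖ (−Δ)^m f ‖_{L^q(ℝᴺ)}. -/

import Mathlib

open MeasureTheory
open scoped ENNReal NNReal

/-- The partial derivative `∂_i f` of a function on `ℝᴺ`. -/
noncomputable def pderivE {N : ℕ} (i : Fin N)
    (f : EuclideanSpace ℝ (Fin N) → ℂ) : EuclideanSpace ℝ (Fin N) → ℂ :=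
  fun x => fderiv ℝ f x (EuclideanSpace.single i 1)

/-- The polyharmonic operator `(-Δ)^m`, the `m`-fold iterate of
`g ↦ -∑ i, ∂²g/∂x_i²`. -/
noncomputable def negLapPow {N : ℕ} (m : ℕ)
    (f : EuclideanSpace ℝ (Fin N) → ℂ) : EuclideanSpace ℝ (Fin N) → ℂ :=
  (fun g x => -∑ i : Fin N, pderivE i (pderivE i g) x)^[m] f

/-- The weak `L^r` quasinorm
`‖g‖_{L^{r,∞}} = sup_{γ>0} γ |{x : |g x| > γ}|^{1/r}`, valued in `ℝ≥0∞`. -/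
noncomputable def weakLpNorm {α : Type*} [MeasurableSpace α]
    (μ : Measure α) (r : ℝ) (g : α → ℝ) : ℝ≥0∞ :=
  ⨆ (γ : ℝ) (_ : 0 < γ), ENNReal.ofReal γ * μ {x | γ < |g x|} ^ (1 / r)

lemma ENNReal.rpow_le_rpow_of_nonpos {s t : ℝ≥0∞} {c : ℝ} (hc : c ≤ 0) (hst : s ≤ t) :
    t ^ c ≤ s ^ c := by
  rw [← neg_neg c, ENNReal.rpow_neg, ENNReal.rpow_neg s, ENNReal.inv_le_inv]
  exact ENNReal.rpow_le_rpow hst (by linarith)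

section RieszPotential

open Module Set

variable {E : Type*} [NormedAddCommGroup E] [NormedSpace ℝ E] [FiniteDimensional ℝ E]
  [MeasurableSpace E] [BorelSpace E]

lemma lintegral_ofReal_fun_norm_addHaar [Nontrivial E] (μ : Measure E) [μ.IsAddHaarMeasure]
    {f : ℝ → ℝ} (hf : ∀ y, 0 ≤ f y)
    (hint : IntegrableOn (fun y : ℝ => y ^ (finrank ℝ E - 1) * f y) (Ioi 0)) :
    ∫⁻ x, ENNReal.ofReal (f ‖x‖) ∂μ = ENNReal.ofReal (finrank ℝ E * μ.real (Metric.ball 0 1)) *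
      ENNReal.ofReal (∫ y in Ioi (0 : ℝ), y ^ (finrank ℝ E - 1) * f y) := by
  rw [← ofReal_integral_eq_lintegral_ofReal ((integrable_fun_norm_addHaar μ).2 hint)
    (Filter.Eventually.of_forall fun x => hf _), integral_fun_norm_addHaar,
    ← ENNReal.ofReal_mul (by positivity)]
  simp [mul_assoc]

lemma pow_pred_mul_rpow {n : ℕ} (hn : 0 < n) {y : ℝ} (hy : 0 < y) (s : ℝ) :
    y ^ (n - 1) * y ^ s = y ^ (s + n - 1) := by
  rw [← Real.rpow_natCast, ← Real.rpow_add hy, Nat.cast_pred hn]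
  ring_nf

lemma lintegral_edist_rpow_le [Nontrivial E] (μ : Measure E) [μ.IsAddHaarMeasure] {a : ℝ}
    (ha : 0 < a) : ∃ C : ℝ≥0, ∀ (x : E) (R : ℝ≥0∞), R ≠ 0 → R ≠ ∞ →
      ∫⁻ y in {y | edist x y ≤ R}, edist x y ^ (a - finrank ℝ E) ∂μ ≤ C * R ^ a := by
  refine ⟨(finrank ℝ E * μ.real (Metric.ball 0 1)).toNNReal * (1 / a).toNNReal, ?_⟩
  intro x R hR0 hR
  lift R to ℝ≥0 using hR
  have hR0 : 0 < (R : ℝ) := by simpa [pos_iff_ne_zero] using hR0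
  have hn : 0 < finrank ℝ E := finrank_pos
  set f : ℝ → ℝ := (Ioc 0 (R : ℝ)).indicator fun y => y ^ (a - finrank ℝ E) with hf
  have hfun : ∀ y ∈ Ioi (0 : ℝ), y ^ (finrank ℝ E - 1) * f y
      = (Ioc 0 (R : ℝ)).indicator (fun y => y ^ (a - 1)) y := by
    intro y hy
    by_cases h : y ∈ Ioc 0 (R : ℝ)
    · rw [hf, indicator_of_mem h, indicator_of_mem h, pow_pred_mul_rpow hn hy]
      ring_nf
    · simp [hf, indicator_of_notMem h]
  have hi : IntegrableOn (fun y : ℝ => y ^ (a - 1)) (Ioc 0 (R : ℝ)) := by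
    rw [← intervalIntegrable_iff_integrableOn_Ioc_of_le hR0.le]
    exact intervalIntegral.intervalIntegrable_rpow' (by linarith)
  have hmain := lintegral_ofReal_fun_norm_addHaar (E := E) μ (f := f)
    (fun y => indicator_nonneg (fun y hy => Real.rpow_nonneg hy.1.le _) y)
    ((integrableOn_congr_fun hfun measurableSet_Ioi).2
      (((integrable_indicator_iff measurableSet_Ioc).2 hi).integrableOn))
  have hval : ∫ y in Ioi (0 : ℝ), y ^ (finrank ℝ E - 1) * f y = 1 / a * (R : ℝ) ^ a := by
    rw [setIntegral_congr_fun measurableSet_Ioi hfun, setIntegral_indicator measurableSet_Ioc,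
      inter_eq_right.2 Ioc_subset_Ioi_self, ← intervalIntegral.integral_of_le hR0.le,
      integral_rpow (Or.inl (by linarith))]
    simp [Real.zero_rpow ha.ne']
    ring
  rw [hval] at hmain
  rw [← lintegral_indicator (measurableSet_le (by fun_prop) measurable_const)]
  have h0 : ∀ᵐ y ∂μ, y ≠ x := by simp [ae_iff]
  calc _ ≤ ∫⁻ y, ENNReal.ofReal (f ‖x - y‖) ∂μ := by
        apply lintegral_mono_ae
        filter_upwards [h0] with y hy
        by_cases h : edist x y ≤ R
        · have hxy : 0 < ‖x - y‖ := norm_pos_iff.2 (sub_ne_zero.2 hy.symm)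
          have h' : ‖x - y‖ ∈ Ioc 0 (R : ℝ) := by
            refine ⟨hxy, ?_⟩
            rw [← dist_eq_norm, ← coe_nndist]
            rw [edist_nndist] at h
            exact_mod_cast h
          rw [indicator_of_mem (show y ∈ {y | edist x y ≤ R} from h), hf, indicator_of_mem h',
            edist_dist, dist_eq_norm, ENNReal.ofReal_rpow_of_pos hxy]
        · rw [indicator_of_notMem (by exact h)]
          exact zero_le
    _ = _ := by
      rw [lintegral_sub_left_eq_self (fun y => ENNReal.ofReal (f ‖y‖)), hmain,
        ENNReal.ofReal_mul (p := 1 / _) (by positivity), ← ENNReal.ofReal_rpow_of_pos hR0,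
        ← mul_assoc, ENNReal.ofReal_coe_nnreal, ENNReal.coe_mul]
      rfl

lemma lintegral_edist_rpow_compl_le [Nontrivial E] (μ : Measure E) [μ.IsAddHaarMeasure] {b : ℝ}
    (hb : b + finrank ℝ E < 0) : ∃ C : ℝ≥0, ∀ (x : E) (R : ℝ≥0∞), R ≠ 0 → R ≠ ∞ →
      ∫⁻ y in {y | R < edist x y}, edist x y ^ b ∂μ ≤ C * R ^ (b + finrank ℝ E) := by
  refine ⟨(finrank ℝ E * μ.real (Metric.ball 0 1)).toNNReal *
    (1 / (-(b + finrank ℝ E))).toNNReal, ?_⟩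
  intro x R hR0 hR
  lift R to ℝ≥0 using hR
  have hR0 : 0 < (R : ℝ) := by simpa [pos_iff_ne_zero] using hR0
  have hn : 0 < finrank ℝ E := finrank_pos
  set f : ℝ → ℝ := (Ioi (R : ℝ)).indicator fun y => y ^ b with hf
  have hfun : ∀ y ∈ Ioi (0 : ℝ), y ^ (finrank ℝ E - 1) * f y
      = (Ioi (R : ℝ)).indicator (fun y => y ^ (b + finrank ℝ E - 1)) y := by
    intro y hy
    by_cases h : y ∈ Ioi (R : ℝ)
    · rw [hf, indicator_of_mem h, indicator_of_mem h, pow_pred_mul_rpow hn hy]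
    · simp [hf, indicator_of_notMem h]
  have hi : IntegrableOn (fun y : ℝ => y ^ (b + finrank ℝ E - 1)) (Ioi (R : ℝ)) :=
    integrableOn_Ioi_rpow_of_lt (by linarith) hR0
  have hmain := lintegral_ofReal_fun_norm_addHaar (E := E) μ (f := f)
    (fun y => indicator_nonneg (fun y hy => Real.rpow_nonneg (hR0.le.trans (le_of_lt hy)) _) y)
    ((integrableOn_congr_fun hfun measurableSet_Ioi).2
      (((integrable_indicator_iff measurableSet_Ioi).2 hi).integrableOn))
  have hval : ∫ y in Ioi (0 : ℝ), y ^ (finrank ℝ E - 1) * f y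
      = 1 / (-(b + finrank ℝ E)) * (R : ℝ) ^ (b + finrank ℝ E) := by
    rw [setIntegral_congr_fun measurableSet_Ioi hfun, setIntegral_indicator measurableSet_Ioi,
      inter_eq_right.2 (Ioi_subset_Ioi hR0.le), integral_Ioi_rpow_of_lt (by linarith) hR0]
    simp only [sub_add_cancel]
    field_simp
  rw [hval] at hmain
  rw [← lintegral_indicator (measurableSet_lt measurable_const (by fun_prop))]
  calc _ ≤ ∫⁻ y, ENNReal.ofReal (f ‖x - y‖) ∂μ := by
        refine lintegral_mono fun y => ?_
        by_cases h : R < edist x y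
        · have h' : ‖x - y‖ ∈ Ioi (R : ℝ) := by
            rw [← dist_eq_norm, ← coe_nndist, mem_Ioi]
            rw [edist_nndist] at h
            exact_mod_cast h
          rw [indicator_of_mem (show y ∈ {y | R < edist x y} from h), hf, indicator_of_mem h',
            edist_dist, dist_eq_norm, ENNReal.ofReal_rpow_of_pos (hR0.trans h')]
        · rw [indicator_of_notMem (by exact h)]
          exact zero_le
    _ = _ := by
      have : 0 < -(b + finrank ℝ E) := by linarith
      rw [lintegral_sub_left_eq_self (fun y => ENNReal.ofReal (f ‖y‖)), hmain,
        ENNReal.ofReal_mul (p := 1 / _) (by positivity), ← ENNReal.ofReal_rpow_of_pos hR0,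
        ← mul_assoc, ENNReal.ofReal_coe_nnreal, ENNReal.coe_mul]
      rfl

lemma lintegral_edist_rpow_mul_edist_rpow_le [Nontrivial E] (μ : Measure E) [μ.IsAddHaarMeasure]
    {a b : ℝ} (ha : 0 < a) (hb : 0 < b) (hab : a + b < finrank ℝ E) :
    ∃ C : ℝ≥0, ∀ x y : E,
      ∫⁻ z, edist x z ^ (a - finrank ℝ E) * edist z y ^ (b - finrank ℝ E) ∂μ
        ≤ C * edist x y ^ (a + b - finrank ℝ E) := by
  set d : ℝ := (finrank ℝ E : ℝ) with hd
  obtain ⟨Ca, hCa⟩ := lintegral_edist_rpow_le (E := E) μ ha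
  obtain ⟨Cb, hCb⟩ := lintegral_edist_rpow_le (E := E) μ hb
  obtain ⟨C, hC⟩ := lintegral_edist_rpow_compl_le (E := E) μ (b := a + b - d - d) (by linarith)
  simp only [← hd] at hCa hCb hC
  refine ⟨(Ca + Cb + C + C + 1) * (2 : ℝ≥0) ^ (d - a - b), fun x y => ?_⟩
  rcases eq_or_ne x y with rfl | hxy
  · rw [edist_self, ENNReal.zero_rpow_of_neg (by linarith), ENNReal.mul_top]
    · exact le_top
    · have : 0 < (Ca + Cb + C + C + 1) * (2 : ℝ≥0) ^ (d - a - b) := by positivity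
      exact_mod_cast this.ne'
  set R : ℝ≥0∞ := edist x y / 2 with hR
  have hD : edist x y ≠ ∞ := edist_ne_top x y
  have hD0 : edist x y ≠ 0 := by simpa using hxy
  have hR0 : R ≠ 0 := by simp [hR, hD0]
  have hRt : R ≠ ∞ := by simp [hR, ENNReal.div_eq_top, hD]
  have hRR : R + R = edist x y := ENNReal.add_halves _
  have htri : ∀ z, edist x y ≤ edist x z + edist y z := fun z => by
    rw [edist_comm y z]; exact edist_triangle x z y
  have hanti : ∀ {s t : ℝ≥0∞} (c : ℝ), c < d → s ≤ t → t ^ (c - d) ≤ s ^ (c - d) :=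
    fun c hc hst => ENNReal.rpow_le_rpow_of_nonpos (by linarith) hst
  have key : ∀ z, edist x z ^ (a - d) * edist z y ^ (b - d) ≤
      {z | edist x z ≤ R}.indicator (fun z => edist x z ^ (a - d)) z * R ^ (b - d) +
      {z | edist y z ≤ R}.indicator (fun z => edist y z ^ (b - d)) z * R ^ (a - d) +
      {z | R < edist x z}.indicator (fun z => edist x z ^ (a + b - d - d)) z +
      {z | R < edist y z}.indicator (fun z => edist y z ^ (a + b - d - d)) z := by
    intro z
    rw [edist_comm z y]
    by_cases h1 : edist x z ≤ R
    · have h2 : R ≤ edist y z := by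
        have := (hRR.le.trans (htri z)).trans (add_le_add_left h1 _)
        exact (ENNReal.add_le_add_iff_left hRt).1 this
      rw [indicator_of_mem (by exact h1)]
      refine le_trans ?_ (le_add_right (le_add_right (le_add_right le_rfl)))
      exact mul_le_mul' le_rfl (hanti b (by linarith) h2)
    by_cases h2 : edist y z ≤ R
    · rw [indicator_of_mem (s := {z | edist y z ≤ R}) (by exact h2)]
      refine le_trans ?_ (le_add_right (le_add_right (le_add_left le_rfl)))
      rw [mul_comm]
      exact mul_le_mul' le_rfl (hanti a (by linarith) (not_le.1 h1).le)
    have e1 : ∀ w : E, R < edist w z → edist w z ^ (a - d) * edist w z ^ (b - d)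
        = edist w z ^ (a + b - d - d) := fun w hw => by
      rw [← ENNReal.rpow_add _ _ (ne_bot_of_gt hw) (edist_ne_top _ _)]
      ring_nf
    rw [indicator_of_mem (s := {z | R < edist x z}) (by exact not_le.1 h1),
      indicator_of_mem (s := {z | R < edist y z}) (by exact not_le.1 h2)]
    rcases le_total (edist x z) (edist y z) with h | h
    · refine le_trans ?_ (le_add_right (le_add_left le_rfl))
      rw [← e1 x (not_le.1 h1)]
      exact mul_le_mul' le_rfl (hanti b (by linarith) h)
    · refine le_trans ?_ (le_add_left le_rfl)
      rw [← e1 y (not_le.1 h2)]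
      exact mul_le_mul' (hanti a (by linarith) h) le_rfl
  have m1 : ∀ (w : E) (c : ℝ), Measurable
      ({z | edist w z ≤ R}.indicator (fun z => edist w z ^ c)) := fun w c =>
    Measurable.indicator (by fun_prop) (measurableSet_le (by fun_prop) measurable_const)
  have m2 : ∀ (w : E) (c : ℝ), Measurable
      ({z | R < edist w z}.indicator (fun z => edist w z ^ c)) := fun w c =>
    Measurable.indicator (by fun_prop) (measurableSet_lt measurable_const (by fun_prop))
  have s1 : ∀ w : E, MeasurableSet {z | edist w z ≤ R} := fun w =>
    measurableSet_le (by fun_prop) measurable_const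
  have s2 : ∀ w : E, MeasurableSet {z | R < edist w z} := fun w =>
    measurableSet_lt measurable_const (by fun_prop)
  have hpow : ∀ s t : ℝ, R ^ s * R ^ t = R ^ (s + t) := fun s t =>
    (ENNReal.rpow_add _ _ hR0 hRt).symm
  calc _ ≤ _ := lintegral_mono key
    _ ≤ Ca * R ^ a * R ^ (b - d) + Cb * R ^ b * R ^ (a - d) + C * R ^ (a + b - d - d + d)
        + C * R ^ (a + b - d - d + d) := by
      rw [lintegral_add_right _ (m2 _ _), lintegral_add_right _ (m2 _ _),
        lintegral_add_right _ ((m1 _ _).mul_const _), lintegral_mul_const _ (m1 _ _),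
        lintegral_mul_const _ (m1 _ _), lintegral_indicator (s1 _), lintegral_indicator (s1 _),
        lintegral_indicator (s2 _), lintegral_indicator (s2 _)]
      gcongr
      · exact hCa x R hR0 hRt
      · exact hCb y R hR0 hRt
      · exact hC x R hR0 hRt
      · exact hC y R hR0 hRt
    _ = (Ca + Cb + C + C) * R ^ (a + b - d) := by
      rw [mul_assoc, mul_assoc, hpow, hpow]
      ring_nf
    _ ≤ (Ca + Cb + C + C + 1) * R ^ (a + b - d) := mul_le_mul' le_self_add le_rfl
    _ = _ := by
      rw [hR, ENNReal.div_eq_inv_mul, ENNReal.mul_rpow_of_ne_top (by simp) hD, ← mul_assoc,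
        ENNReal.inv_rpow, ← ENNReal.rpow_neg, ENNReal.coe_mul,
        ENNReal.coe_rpow_of_ne_zero (by simp)]
      simp only [ENNReal.coe_add, ENNReal.coe_one, ENNReal.coe_ofNat]
      ring_nf

end RieszPotential

section Interpolation

open Set

lemma lintegral_Ioi_rpow_indicator_lt {c : ℝ} (hc : 0 < c) (s : ℝ≥0∞) :
    ∫⁻ t in Ioi (0 : ℝ), {t | ENNReal.ofReal t < s}.indicator
      (fun t => ENNReal.ofReal (t ^ (c - 1))) t = ENNReal.ofReal (1 / c) * s ^ c := by
  have key : ∀ x : ℝ≥0, ∫⁻ t in Ioi (0 : ℝ), {t | ENNReal.ofReal t < x}.indicator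
      (fun t => ENNReal.ofReal (t ^ (c - 1))) t = ENNReal.ofReal (1 / c) * x ^ c := by
    intro x
    have hset : Ioi 0 ∩ {t : ℝ | ENNReal.ofReal t < x} = Ioo 0 (x : ℝ) := by
      ext t
      simp only [mem_inter_iff, mem_Ioi, mem_ofPred_eq, mem_Ioo, and_congr_right_iff]
      intro ht
      rw [← ENNReal.ofReal_coe_nnreal, ENNReal.ofReal_lt_ofReal_iff_of_nonneg ht.le]
    rw [setLIntegral_indicator (measurableSet_lt (by fun_prop) measurable_const), inter_comm, hset]
    have hi : IntegrableOn (fun y : ℝ => y ^ (c - 1)) (Ioc 0 (x : ℝ)) := by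
      rw [← intervalIntegrable_iff_integrableOn_Ioc_of_le x.coe_nonneg]
      exact intervalIntegral.intervalIntegrable_rpow' (by linarith)
    rw [restrict_Ioo_eq_restrict_Ioc, ← ofReal_integral_eq_lintegral_ofReal hi,
      ← intervalIntegral.integral_of_le x.coe_nonneg, integral_rpow (Or.inl (by linarith)),
      sub_add_cancel, Real.zero_rpow hc.ne', sub_zero, div_eq_mul_inv, mul_comm, ← one_div,
      ENNReal.ofReal_mul (by positivity), ← ENNReal.ofReal_rpow_of_nonneg x.coe_nonneg hc.le]
    · simp
    · filter_upwards [ae_restrict_mem measurableSet_Ioc] with t ht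
      exact Real.rpow_nonneg ht.1.le _
  induction s with
  | coe x => exact key x
  | top =>
    rw [ENNReal.top_rpow_of_pos hc, ENNReal.mul_top (by simpa using hc)]
    refine ENNReal.eq_top_of_forall_nnreal_le fun r => ?_
    have hx := key ((c.toNNReal * r) ^ (1 / c))
    have : ENNReal.ofReal (1 / c) * ((c.toNNReal * r) ^ (1 / c) : ℝ≥0) ^ c = r := by
      rw [← ENNReal.coe_rpow_of_nonneg _ hc.le, ← NNReal.rpow_mul, one_div_mul_cancel hc.ne',
        NNReal.rpow_one, ENNReal.coe_mul, ← mul_assoc]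
      change ENNReal.ofReal (1 / c) * ENNReal.ofReal c * r = r
      rw [← ENNReal.ofReal_mul (by positivity), one_div_mul_cancel hc.ne']
      simp
    rw [this] at hx
    rw [← hx]
    refine lintegral_mono fun t => indicator_le_indicator_of_subset ?_ (by simp) t
    exact fun t _ => ENNReal.ofReal_lt_top

lemma lintegral_Ioi_rpow_indicator_ge {c : ℝ} (hc : c < 0) (s : ℝ≥0∞) :
    ∫⁻ t in Ioi (0 : ℝ), {t | s ≤ ENNReal.ofReal t}.indicator
      (fun t => ENNReal.ofReal (t ^ (c - 1))) t ≤ ENNReal.ofReal (-(1 / c)) * s ^ c := by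
  rcases eq_or_ne s 0 with rfl | hs0
  · rw [ENNReal.zero_rpow_of_neg hc, ENNReal.mul_top (by simpa using hc)]
    exact le_top
  induction s with
  | top => simp
  | coe x =>
    have hx : 0 < (x : ℝ) := by simpa [pos_iff_ne_zero] using hs0
    have hset : Ioi 0 ∩ {t : ℝ | x ≤ ENNReal.ofReal t} = Ici (x : ℝ) := by
      ext t
      simp only [mem_inter_iff, mem_Ioi, mem_ofPred_eq, mem_Ici]
      rw [← ENNReal.ofReal_coe_nnreal]
      refine ⟨fun h => (ENNReal.ofReal_le_ofReal_iff h.1.le).1 h.2, fun h => ⟨hx.trans_le h, ?_⟩⟩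
      exact ENNReal.ofReal_le_ofReal h
    rw [setLIntegral_indicator (measurableSet_le measurable_const (by fun_prop)), inter_comm, hset,
      setLIntegral_congr Ioi_ae_eq_Ici.symm,
      ← ofReal_integral_eq_lintegral_ofReal (integrableOn_Ioi_rpow_of_lt (by linarith) hx),
      integral_Ioi_rpow_of_lt (by linarith) hx, sub_add_cancel, ← ENNReal.ofReal_coe_nnreal,
      ENNReal.ofReal_rpow_of_pos hx, ← ENNReal.ofReal_mul (by
        rw [← one_div_neg_eq_neg_one_div]; have : 0 < -c := by linarith
        positivity)]
    · apply le_of_eq; congr 1; ring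
    · filter_upwards [ae_restrict_mem measurableSet_Ioi] with t ht
      exact Real.rpow_nonneg (hx.trans ht).le _

lemma ENNReal.rpow_mul_rpow_sub_le {p q : ℝ} (hq : 0 < q) (s : ℝ≥0∞) (hp : 0 < p) :
    s ^ p * s ^ (q - p) ≤ s ^ q := by
  rcases eq_or_ne s 0 with rfl | hs0
  · simp [ENNReal.zero_rpow_of_pos hp]
  rcases eq_or_ne s ∞ with rfl | hs
  · simp [ENNReal.top_rpow_of_pos hq]
  rw [← ENNReal.rpow_add _ _ hs0 hs]
  simp

lemma lintegral_rpow_eq_lintegral_meas_ofReal_lt {α : Type*} [MeasurableSpace α] (μ : Measure α)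
    [SFinite μ] {F : α → ℝ≥0∞} (hF : Measurable F) {q : ℝ} (hq : 0 < q) :
    ∫⁻ x, F x ^ q ∂μ = ENNReal.ofReal q *
      ∫⁻ t in Ioi (0 : ℝ), ENNReal.ofReal (t ^ (q - 1)) * μ {x | ENNReal.ofReal t < F x} := by
  have h1 : ∀ x, F x ^ q = ENNReal.ofReal q * ∫⁻ t in Ioi (0 : ℝ),
      {t | ENNReal.ofReal t < F x}.indicator (fun t => ENNReal.ofReal (t ^ (q - 1))) t := by
    intro x
    rw [lintegral_Ioi_rpow_indicator_lt hq, ← mul_assoc, ← ENNReal.ofReal_mul hq.le,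
      mul_one_div_cancel hq.ne']
    simp
  simp_rw [h1]
  have hm : Measurable (Function.uncurry fun (x : α) (t : ℝ) =>
      {t | ENNReal.ofReal t < F x}.indicator (fun t => ENNReal.ofReal (t ^ (q - 1))) t) := by
    exact Measurable.indicator (s := {z : α × ℝ | ENNReal.ofReal z.2 < F z.1})
      (f := fun z => ENNReal.ofReal (z.2 ^ (q - 1))) (by fun_prop)
      (measurableSet_lt (by fun_prop) (by fun_prop))
  rw [lintegral_const_mul _ (by exact hm.lintegral_prod_right'),
    lintegral_lintegral_swap hm.aemeasurable]
  congr 2 with t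
  rw [← lintegral_indicator_const (measurableSet_lt measurable_const hF)]
  rfl

lemma exists_lintegral_rpow_le_of_weakType {α β : Type*} [MeasurableSpace α] [MeasurableSpace β]
    (μ : Measure α) [SFinite μ] (ν : Measure β) [SFinite ν] {p₀ p₁ q : ℝ} (hp₀ : 0 < p₀)
    (hp₀q : p₀ < q) (hqp₁ : q < p₁) (C₀ C₁ : ℝ≥0) :
    ∃ C : ℝ≥0, ∀ T : (α → ℝ≥0∞) → β → ℝ≥0∞,
      (∀ g h, Measurable g → Measurable h → ∀ x, T (g + h) x ≤ T g x + T h x) →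
      (∀ g, Measurable g → ∀ t : ℝ≥0∞, t ≠ 0 → t ≠ ∞ →
        ν {x | t < T g x} ≤ C₀ * t ^ (-p₀) * ∫⁻ x, g x ^ p₀ ∂μ) →
      (∀ g, Measurable g → ∀ t : ℝ≥0∞, t ≠ 0 → t ≠ ∞ →
        ν {x | t < T g x} ≤ C₁ * t ^ (-p₁) * ∫⁻ x, g x ^ p₁ ∂μ) →
      ∀ g, Measurable g → Measurable (T g) →
        ∫⁻ x, T g x ^ q ∂ν ≤ C * ∫⁻ x, g x ^ q ∂μ := by
  have hq : 0 < q := hp₀.trans hp₀q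
  have hp₁ : 0 < p₁ := hq.trans hqp₁
  refine ⟨q.toNNReal * (C₀ * 2 ^ p₀ * (1 / (q - p₀)).toNNReal +
    C₁ * 2 ^ p₁ * (-(1 / (q - p₁))).toNNReal), fun T hT h₀ h₁ g hg hTg => ?_⟩
  have hsplit : ∀ t : ℝ, 0 < t → ENNReal.ofReal (t ^ (q - 1)) * ν {x | ENNReal.ofReal t < T g x} ≤
      (C₀ * 2 ^ p₀ : ℝ≥0) * ∫⁻ x, g x ^ p₀ * {t | ENNReal.ofReal t < g x}.indicator
        (fun t => ENNReal.ofReal (t ^ (q - p₀ - 1))) t ∂μ +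
      (C₁ * 2 ^ p₁ : ℝ≥0) * ∫⁻ x, g x ^ p₁ * {t | g x ≤ ENNReal.ofReal t}.indicator
        (fun t => ENNReal.ofReal (t ^ (q - p₁ - 1))) t ∂μ := by
    intro t ht
    have ht0 : ENNReal.ofReal (t / 2) ≠ 0 := by simpa using ht
    have htt : ENNReal.ofReal (t / 2) ≠ ∞ := ENNReal.ofReal_ne_top
    set S : Set α := {x | ENNReal.ofReal t < g x} with hS
    have hSm : MeasurableSet S := measurableSet_lt measurable_const hg
    have hsum : g = S.indicator g + Sᶜ.indicator g := (indicator_self_add_compl S g).symm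
    have hsub : {x | ENNReal.ofReal t < T g x} ⊆
      {x | ENNReal.ofReal (t / 2) < T (S.indicator g) x} ∪
        {x | ENNReal.ofReal (t / 2) < T (Sᶜ.indicator g) x} := by
      intro x hx
      by_contra hcon
      simp only [mem_union, mem_ofPred_eq, not_or, not_lt] at hcon
      refine absurd (show ENNReal.ofReal t < T g x from hx) (not_lt.2 ?_)
      rw [hsum]
      refine (hT _ _ (hg.indicator hSm) (hg.indicator hSm.compl) x).trans
        ((add_le_add hcon.1 hcon.2).trans ?_)
      rw [← ENNReal.ofReal_add (by positivity) (by positivity), add_halves]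
    have hmul : ∀ (p : ℝ) (C : ℝ≥0) (A : Set α) (_ : 0 < p) (_ : MeasurableSet A),
        ENNReal.ofReal (t ^ (q - 1)) *
          (C * ENNReal.ofReal (t / 2) ^ (-p) * ∫⁻ x, A.indicator g x ^ p ∂μ) =
        (C * 2 ^ p : ℝ≥0) * ∫⁻ x, g x ^ p *
          A.indicator (fun _ => ENNReal.ofReal (t ^ (q - p - 1))) x ∂μ := by
      intro p C A hp hA
      have e1 : ∀ x, g x ^ p * A.indicator (fun _ => ENNReal.ofReal (t ^ (q - p - 1))) x
          = A.indicator g x ^ p * ENNReal.ofReal (t ^ (q - p - 1)) := by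
        intro x
        by_cases hx : x ∈ A <;> simp [hx, hp]
      simp_rw [e1]
      rw [lintegral_mul_const _ ((hg.indicator hA).pow_const p)]
      have e2 : ENNReal.ofReal (t / 2) ^ (-p) = (2 : ℝ≥0) ^ p * ENNReal.ofReal (t ^ (-p)) := by
        rw [ENNReal.ofReal_rpow_of_pos (by positivity), Real.div_rpow ht.le (by positivity),
          Real.rpow_neg zero_le_two, div_inv_eq_mul, ENNReal.ofReal_mul (by positivity), mul_comm,
          ← ENNReal.ofReal_rpow_of_pos zero_lt_two]
        simp
      have e3 : ENNReal.ofReal (t ^ (q - p - 1))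
          = ENNReal.ofReal (t ^ (q - 1)) * ENNReal.ofReal (t ^ (-p)) := by
        rw [← ENNReal.ofReal_mul (by positivity), ← Real.rpow_add ht]
        ring_nf
      rw [e2, e3, ENNReal.coe_mul, ENNReal.coe_rpow_of_nonneg _ hp.le]
      ring
    have hc : Sᶜ = {x | g x ≤ ENNReal.ofReal t} := by ext; simp [hS]
    calc _ ≤ ENNReal.ofReal (t ^ (q - 1)) *
          (C₀ * ENNReal.ofReal (t / 2) ^ (-p₀) * (∫⁻ x, S.indicator g x ^ p₀ ∂μ) +
          C₁ * ENNReal.ofReal (t / 2) ^ (-p₁) * ∫⁻ x, Sᶜ.indicator g x ^ p₁ ∂μ) := by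
          gcongr
          exact (measure_mono hsub).trans ((measure_union_le _ _).trans (add_le_add
            (h₀ _ (hg.indicator hSm) _ ht0 htt) (h₁ _ (hg.indicator hSm.compl) _ ht0 htt)))
      _ = _ := by
          rw [mul_add, hmul p₀ C₀ S hp₀ hSm, hmul p₁ C₁ Sᶜ hp₁ hSm.compl, hc]
          rfl
  have hm₀ : Measurable (Function.uncurry fun (t : ℝ) (x : α) => g x ^ p₀ *
      {t | ENNReal.ofReal t < g x}.indicator (fun t => ENNReal.ofReal (t ^ (q - p₀ - 1))) t) := by
    refine Measurable.mul (by fun_prop) ?_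
    exact Measurable.indicator (s := {z : ℝ × α | ENNReal.ofReal z.1 < g z.2})
      (f := fun z => ENNReal.ofReal (z.1 ^ (q - p₀ - 1))) (by fun_prop)
      (measurableSet_lt (by fun_prop) (by fun_prop))
  have hm₁ : Measurable (Function.uncurry fun (t : ℝ) (x : α) => g x ^ p₁ *
      {t | g x ≤ ENNReal.ofReal t}.indicator (fun t => ENNReal.ofReal (t ^ (q - p₁ - 1))) t) := by
    refine Measurable.mul (by fun_prop) ?_
    exact Measurable.indicator (s := {z : ℝ × α | g z.2 ≤ ENNReal.ofReal z.1})
      (f := fun z => ENNReal.ofReal (z.1 ^ (q - p₁ - 1))) (by fun_prop)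
      (measurableSet_le (by fun_prop) (by fun_prop))
  rw [lintegral_rpow_eq_lintegral_meas_ofReal_lt ν hTg hq]
  calc _ ≤ ENNReal.ofReal q * ∫⁻ t in Ioi (0 : ℝ),
        ((C₀ * 2 ^ p₀ : ℝ≥0) * ∫⁻ x, g x ^ p₀ * {t | ENNReal.ofReal t < g x}.indicator
          (fun t => ENNReal.ofReal (t ^ (q - p₀ - 1))) t ∂μ +
        (C₁ * 2 ^ p₁ : ℝ≥0) * ∫⁻ x, g x ^ p₁ * {t | g x ≤ ENNReal.ofReal t}.indicator
          (fun t => ENNReal.ofReal (t ^ (q - p₁ - 1))) t ∂μ) := by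
        gcongr ENNReal.ofReal q * ?_
        exact setLIntegral_mono' measurableSet_Ioi hsplit
    _ ≤ ENNReal.ofReal q * (
        (C₀ * 2 ^ p₀ : ℝ≥0) * (ENNReal.ofReal (1 / (q - p₀)) * ∫⁻ x, g x ^ q ∂μ) +
        (C₁ * 2 ^ p₁ : ℝ≥0) * (ENNReal.ofReal (-(1 / (q - p₁))) * ∫⁻ x, g x ^ q ∂μ)) := by
        gcongr ENNReal.ofReal q * ?_
        rw [lintegral_add_left (by exact hm₀.lintegral_prod_right'.const_mul _),
          lintegral_const_mul _ (by exact hm₀.lintegral_prod_right'),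
          lintegral_const_mul _ (by exact hm₁.lintegral_prod_right'),
          lintegral_lintegral_swap hm₀.aemeasurable, lintegral_lintegral_swap hm₁.aemeasurable,
          ← lintegral_const_mul _ (hg.pow_const q), ← lintegral_const_mul _ (hg.pow_const q)]
        gcongr with x x
        · rw [lintegral_const_mul _ (by
            exact Measurable.indicator (by fun_prop)
              (measurableSet_lt (by fun_prop) measurable_const)),
            lintegral_Ioi_rpow_indicator_lt (by linarith), mul_left_comm]
          gcongr
          exact ENNReal.rpow_mul_rpow_sub_le hq _ hp₀
        · rw [lintegral_const_mul _ (by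
            exact Measurable.indicator (by fun_prop)
              (measurableSet_le measurable_const (by fun_prop)))]
          refine (mul_le_mul' le_rfl (lintegral_Ioi_rpow_indicator_ge (by linarith) _)).trans ?_
          rw [mul_left_comm]
          gcongr
          exact ENNReal.rpow_mul_rpow_sub_le hq _ hp₁
    _ = _ := by
        simp only [ENNReal.coe_mul, ENNReal.coe_add, ENNReal.ofReal]
        ring

end Interpolation

section WeakTypeRiesz

open Module Set

variable {E : Type*} [NormedAddCommGroup E] [NormedSpace ℝ E] [FiniteDimensional ℝ E]
  [MeasurableSpace E] [BorelSpace E]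

/-- The Riesz potential of order `a`, without normalising constant, of a nonnegative function. -/
noncomputable def rieszPotential (μ : Measure E) (a : ℝ) (g : E → ℝ≥0∞) (x : E) : ℝ≥0∞ :=
  ∫⁻ y, edist x y ^ (a - finrank ℝ E) * g y ∂μ

lemma measurable_rieszPotential (μ : Measure E) [SFinite μ] (a : ℝ) {g : E → ℝ≥0∞}
    (hg : Measurable g) : Measurable (rieszPotential μ a g) := by
  have : Measurable (Function.uncurry fun x y : E => edist x y ^ (a - finrank ℝ E) * g y) := by
    unfold Function.uncurry
    fun_prop
  exact this.lintegral_prod_right'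

omit [FiniteDimensional ℝ E] in
lemma rieszPotential_add (μ : Measure E) (a : ℝ) {g h : E → ℝ≥0∞} (hg : Measurable g) (x : E) :
    rieszPotential μ a (g + h) x = rieszPotential μ a g x + rieszPotential μ a h x := by
  simp only [rieszPotential, Pi.add_apply, mul_add]
  exact lintegral_add_left (by fun_prop) _

/-- Schur's test. -/
lemma lintegral_rpow_lintegral_mul_le {α β : Type*} [MeasurableSpace α] [MeasurableSpace β]
    (μ : Measure α) [SFinite μ] (ν : Measure β) [SFinite ν] {k : α → β → ℝ≥0∞}
    (hk : Measurable (Function.uncurry k)) {p : ℝ} (hp : 1 < p) {A : ℝ≥0∞}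
    (hA : ∀ x, ∫⁻ y, k x y ∂ν ≤ A) (hA' : ∀ y, ∫⁻ x, k x y ∂μ ≤ A) {g : β → ℝ≥0∞}
    (hg : Measurable g) :
    ∫⁻ x, (∫⁻ y, k x y * g y ∂ν) ^ p ∂μ ≤ A ^ p * ∫⁻ y, g y ^ p ∂ν := by
  have hpq := Real.HolderConjugate.conjExponent hp
  set q := p.conjExponent
  have hp0 : 0 < p := hpq.pos
  have hpt : ∀ x, (∫⁻ y, k x y * g y ∂ν) ^ p ≤ A ^ (p - 1) * ∫⁻ y, k x y * g y ^ p ∂ν := by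
    intro x
    have hkx : Measurable (k x) := hk.of_uncurry_left
    have e : ∀ y, k x y * g y = (k x y ^ (1 / q)) * (k x y ^ (1 / p) * g y) := by
      intro y
      rw [← mul_assoc, ← ENNReal.rpow_add_of_nonneg _ _ hpq.symm.one_div_nonneg hpq.one_div_nonneg,
        add_comm, one_div, one_div, hpq.inv_add_inv_eq_one, ENNReal.rpow_one]
    calc _ = (∫⁻ y, (k x y ^ (1 / q)) * (k x y ^ (1 / p) * g y) ∂ν) ^ p := by simp_rw [← e]
      _ ≤ ((∫⁻ y, (k x y ^ (1 / q)) ^ q ∂ν) ^ (1 / q) *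
          (∫⁻ y, (k x y ^ (1 / p) * g y) ^ p ∂ν) ^ (1 / p)) ^ p := by
        gcongr
        exact ENNReal.lintegral_mul_le_Lp_mul_Lq ν hpq.symm (by fun_prop) (by fun_prop)
      _ = (∫⁻ y, k x y ∂ν) ^ (p - 1) * ∫⁻ y, k x y * g y ^ p ∂ν := by
        simp_rw [ENNReal.mul_rpow_of_nonneg _ _ hp0.le, ← ENNReal.rpow_mul,
          one_div_mul_cancel hpq.symm.ne_zero, one_div_mul_cancel hpq.ne_zero, ENNReal.rpow_one]
        congr 2
        rw [← hpq.div_conj_eq_sub_one]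
        ring
      _ ≤ _ := mul_le_mul' (ENNReal.rpow_le_rpow (hA x) (by linarith)) le_rfl
  have hm : Measurable (Function.uncurry fun x y => k x y * g y ^ p) := by
    unfold Function.uncurry at hk ⊢
    fun_prop
  calc _ ≤ ∫⁻ x, A ^ (p - 1) * ∫⁻ y, k x y * g y ^ p ∂ν ∂μ := lintegral_mono hpt
    _ = A ^ (p - 1) * ∫⁻ y, (∫⁻ x, k x y ∂μ) * g y ^ p ∂ν := by
      rw [lintegral_const_mul _ (by exact hm.lintegral_prod_right'),
        lintegral_lintegral_swap hm.aemeasurable]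
      congr 2 with y
      exact lintegral_mul_const _ hk.of_uncurry_right
    _ ≤ A ^ (p - 1) * ∫⁻ y, A * g y ^ p ∂ν := by
      gcongr with y
      exact hA' y
    _ = _ := by
      rw [lintegral_const_mul _ (by fun_prop), ← mul_assoc]
      congr 1
      nth_rw 2 [← ENNReal.rpow_one A]
      rw [← ENNReal.rpow_add_of_nonneg _ _ (by linarith) zero_le_one, sub_add_cancel]

lemma exists_meas_lt_mul_rieszPotential_le [Nontrivial E] (μ : Measure E) [μ.IsAddHaarMeasure]
    {a p : ℝ} (ha : 0 < a) (hp : 1 < p) (hap : a * p < finrank ℝ E) :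
    ∃ C : ℝ≥0, ∀ v : E → ℝ≥0∞, (∀ t, μ {x | t < v x} ≤ t ^ (-(finrank ℝ E / a))) →
      ∀ g, Measurable g → ∀ t : ℝ≥0∞, t ≠ 0 → t ≠ ∞ →
        μ {x | t < v x * rieszPotential μ a g x} ≤ C * t ^ (-p) * ∫⁻ x, g x ^ p ∂μ := by
  have hpq := Real.HolderConjugate.conjExponent hp
  set q := p.conjExponent
  have hp0 : 0 < p := hpq.pos
  have hq0 : 0 < q := hpq.symm.pos
  set d : ℝ := (finrank ℝ E : ℝ) with hd
  have hd0 : 0 < d := by nlinarith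
  have hqp : 1 / q = 1 - 1 / p := by
    have := hpq.inv_add_inv_eq_one
    simp only [one_div]; linarith
  have hexp : (a - d) * q + d < 0 := by
    have h1 : (a - d) * q + d = (a - d / p) * q := by
      have : 1 = q * (1 - 1 / p) := by rw [← hqp]; field_simp
      linear_combination d * this
    rw [h1]
    refine mul_neg_of_neg_of_pos (sub_neg.2 ?_) hq0
    rwa [lt_div_iff₀ hp0]
  obtain ⟨C₁, hC₁⟩ := lintegral_edist_rpow_le (E := E) μ ha
  obtain ⟨C₂, hC₂⟩ := lintegral_edist_rpow_compl_le (E := E) μ (b := (a - d) * q) hexp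
  simp only [← hd] at hC₁ hC₂
  set K : ℝ≥0 := C₁ + C₂ ^ (1 / q) + 1 with hK
  have hK0 : (K : ℝ≥0∞) ≠ 0 := by simp [hK]
  refine ⟨2 * (2 * K) ^ p, fun v hv g hg t ht0 ht => ?_⟩
  rw [ENNReal.coe_mul, ENNReal.coe_rpow_of_nonneg _ hp0.le]
  push_cast
  rcases eq_or_ne (∫⁻ x, g x ^ p ∂μ) 0 with hG0 | hG0
  · have hg0 : g =ᵐ[μ] 0 := by
      rw [lintegral_eq_zero_iff (by fun_prop)] at hG0
      filter_upwards [hG0] with x hx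
      simpa [hp0, hp0.le, hp0.not_gt] using hx
    have hI : ∀ x, rieszPotential μ a g x = 0 := by
      intro x
      refine lintegral_eq_zero_of_ae_eq_zero ?_
      filter_upwards [hg0] with y hy
      simp [hy]
    simp [hI]
  rcases eq_or_ne (∫⁻ x, g x ^ p ∂μ) ∞ with hGt | hGt
  · rw [hGt, ENNReal.mul_top]
    · exact le_top
    · simp [hK0, ht0, ht, hp0.not_gt]
  set γ : ℝ≥0∞ := (∫⁻ x, g x ^ p ∂μ) ^ (1 / p) with hγ
  have hγp : γ ^ p = ∫⁻ x, g x ^ p ∂μ := by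
    rw [hγ, ← ENNReal.rpow_mul, one_div_mul_cancel hp0.ne', ENNReal.rpow_one]
  have hγ0 : γ ≠ 0 := by
    intro h; rw [h, ENNReal.zero_rpow_of_pos hp0] at hγp; exact hG0 hγp.symm
  have hγt : γ ≠ ∞ := by
    intro h; rw [h, ENNReal.top_rpow_of_pos hp0] at hγp; exact hGt hγp.symm
  rw [← hγp]
  set Q : ℝ≥0∞ := 2 * K * γ / t with hQ
  have hQ0 : Q ≠ 0 := by simp [hQ, hK0, hγ0, ht]
  have hQt : Q ≠ ∞ := by simp [hQ, ENNReal.div_eq_top, ht0, ht, ENNReal.mul_eq_top, hγt]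
  set R : ℝ≥0∞ := Q ^ (p / d) with hR
  have hR0 : R ≠ 0 := by simp [hR, hQ0, hQt]
  have hRt : R ≠ ∞ := by simp [hR, hQ0, hQt]
  have hRd : R ^ d = Q ^ p := by rw [hR, ← ENNReal.rpow_mul, div_mul_cancel₀ _ hd0.ne']
  have hRdp : R ^ (-(d / p)) = Q⁻¹ := by
    rw [hR, ← ENNReal.rpow_mul, ← ENNReal.rpow_neg_one]
    congr 1
    field_simp
  clear_value R Q
  have hpow : ∀ s s' : ℝ, R ^ s * R ^ s' = R ^ (s + s') := fun s s' =>
    (ENNReal.rpow_add _ _ hR0 hRt).symm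
  set S : ℝ≥0∞ := K * R ^ (a - d / p) * γ with hS
  have hpow0 : ∀ s : ℝ, R ^ s ≠ 0 := fun s => by simp [hR0, hRt]
  have hpowt : ∀ s : ℝ, R ^ s ≠ ∞ := fun s => by simp [hR0, hRt]
  have hS0 : S ≠ 0 := by
    simp only [hS, ne_eq, mul_eq_zero, hK0, hpow0, hγ0, or_self, not_false_eq_true]
  have hSt : S ≠ ∞ := ENNReal.mul_ne_top (ENNReal.mul_ne_top ENNReal.coe_ne_top (hpowt _)) hγt
  clear_value S
  have htS : R ^ (-a) * (S + S) = t := by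
    have : R ^ (-a) * R ^ (a - d / p) = Q⁻¹ := by rw [hpow, ← hRdp]; ring_nf
    calc R ^ (-a) * (S + S) = 2 * K * γ * (R ^ (-a) * R ^ (a - d / p)) := by rw [hS]; ring
      _ = t := by
        rw [this, hQ, ENNReal.inv_div (Or.inl ht) (Or.inl ht0)]
        refine ENNReal.mul_div_cancel ?_ ?_
        · simp [hK0, hγ0]
        · simp [ENNReal.mul_eq_top, hγt]
  have hsm : ∀ x : E, MeasurableSet {y | edist x y ≤ R} := fun x =>
    measurableSet_le (by fun_prop) measurable_const
  set near : E → ℝ≥0∞ := fun x =>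
    ∫⁻ y, {y | edist x y ≤ R}.indicator (fun y => edist x y ^ (a - d)) y * g y ∂μ with hnear
  have hfar : ∀ x, rieszPotential μ a g x ≤ near x + S := by
    intro x
    rw [rieszPotential, ← lintegral_add_compl _ (hsm x)]
    gcongr ?_ + ?_
    · rw [hnear, ← lintegral_indicator (hsm x)]
      refine lintegral_mono fun y => ?_
      simp only [indicator_mul_left]
      exact le_rfl
    · have hc : {y | edist x y ≤ R}ᶜ = {y | R < edist x y} := by ext; simp
      rw [hc]
      calc _ ≤ (∫⁻ y in {y | R < edist x y}, (edist x y ^ (a - d)) ^ q ∂μ) ^ (1 / q) *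
            (∫⁻ y in {y | R < edist x y}, g y ^ p ∂μ) ^ (1 / p) :=
            ENNReal.lintegral_mul_le_Lp_mul_Lq _ hpq.symm (by fun_prop) (by fun_prop)
        _ ≤ (C₂ * R ^ ((a - d) * q + d)) ^ (1 / q) * γ := by
          simp_rw [← ENNReal.rpow_mul]
          exact mul_le_mul' (ENNReal.rpow_le_rpow (hC₂ x R hR0 hRt) (by positivity))
            (ENNReal.rpow_le_rpow (setLIntegral_le_lintegral _ _) (by positivity))
        _ = C₂ ^ (1 / q) * R ^ (a - d / p) * γ := by
          rw [ENNReal.mul_rpow_of_nonneg _ _ (by positivity), ← ENNReal.rpow_mul]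
          congr 3
          rw [add_mul, mul_assoc, mul_one_div_cancel hq0.ne', hqp]
          ring
        _ ≤ S := by
          rw [hS]
          gcongr
          rw [← ENNReal.coe_rpow_of_nonneg _ (by positivity), ENNReal.coe_le_coe, hK, add_assoc,
            add_left_comm]
          exact le_self_add
  have hkm : Measurable (Function.uncurry fun x y : E =>
      {y | edist x y ≤ R}.indicator (fun y => edist x y ^ (a - d)) y) :=
    Measurable.indicator (s := {z : E × E | edist z.1 z.2 ≤ R})
      (f := fun z => edist z.1 z.2 ^ (a - d)) (by fun_prop)
      (measurableSet_le (by fun_prop) measurable_const)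
  have hnearp : ∫⁻ x, near x ^ p ∂μ ≤ (C₁ * R ^ a) ^ p * γ ^ p := by
    rw [hγp]
    have hl : ∀ x : E, ∫⁻ y, {y | edist x y ≤ R}.indicator (fun y => edist x y ^ (a - d)) y ∂μ
        ≤ C₁ * R ^ a := fun x => by
      rw [lintegral_indicator (hsm x)]
      exact hC₁ x R hR0 hRt
    refine lintegral_rpow_lintegral_mul_le μ μ hkm hp hl (fun y => ?_) hg
    refine le_trans (le_of_eq (lintegral_congr fun x => ?_)) (hl y)
    simp only [indicator, mem_ofPred_eq, edist_comm x y]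
  have hnearS : μ {x | S < near x} ≤ R ^ d := by
    have hnm : Measurable near := by
      have : Measurable (Function.uncurry fun x y : E =>
          {y | edist x y ≤ R}.indicator (fun y => edist x y ^ (a - d)) y * g y) :=
        hkm.mul (hg.comp measurable_snd)
      exact this.lintegral_prod_right'
    have hsub : {x | S < near x} ⊆ {x | S ^ p ≤ near x ^ p} := fun x hx =>
      ENNReal.rpow_le_rpow (le_of_lt hx) hp0.le
    have hSp0 : S ^ p ≠ 0 := by simp [hS0, hSt]
    have hSpt : S ^ p ≠ ∞ := by simp [hS0, hSt]
    refine (measure_mono hsub).trans ((meas_ge_le_lintegral_div (hnm.pow_const p).aemeasurable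
      hSp0 hSpt).trans ?_)
    rw [ENNReal.div_le_iff hSp0 hSpt]
    refine hnearp.trans ?_
    have e : (R ^ a) ^ p = R ^ d * (R ^ (a - d / p)) ^ p := by
      rw [← ENNReal.rpow_mul, ← ENNReal.rpow_mul, hpow]
      congr 1
      field_simp
      ring
    rw [hS, ENNReal.mul_rpow_of_nonneg _ _ hp0.le, ENNReal.mul_rpow_of_nonneg _ _ hp0.le,
      ENNReal.mul_rpow_of_nonneg _ _ hp0.le, e]
    have hCK : (C₁ : ℝ≥0∞) ^ p ≤ (K : ℝ≥0∞) ^ p := by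
      refine ENNReal.rpow_le_rpow (ENNReal.coe_le_coe.2 ?_) hp0.le
      rw [hK, add_assoc]
      exact le_self_add
    calc (C₁ : ℝ≥0∞) ^ p * (R ^ d * (R ^ (a - d / p)) ^ p) * γ ^ p
        ≤ (K : ℝ≥0∞) ^ p * (R ^ d * (R ^ (a - d / p)) ^ p) * γ ^ p :=
          mul_le_mul' (mul_le_mul' hCK le_rfl) le_rfl
      _ = _ := by ring
  have hsub : {x | t < v x * rieszPotential μ a g x} ⊆ {x | R ^ (-a) < v x} ∪ {x | S < near x} := by
    intro x hx
    by_contra hcon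
    simp only [mem_union, mem_ofPred_eq, not_or, not_lt] at hcon
    refine absurd (show t < v x * rieszPotential μ a g x from hx) (not_lt.2 ?_)
    rw [← htS]
    exact mul_le_mul' hcon.1 ((hfar x).trans (add_le_add_left hcon.2 _))
  calc _ ≤ R ^ d + R ^ d := by
        refine (measure_mono hsub).trans ((measure_union_le _ _).trans (add_le_add ?_ hnearS))
        refine (hv _).trans (le_of_eq ?_)
        rw [← ENNReal.rpow_mul]
        congr 1
        field_simp
    _ = _ := by
        rw [hRd, hQ, ENNReal.div_rpow_of_nonneg _ _ hp0.le, ENNReal.mul_rpow_of_nonneg _ _ hp0.le,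
          ENNReal.rpow_neg, div_eq_mul_inv]
        ring

lemma exists_lintegral_mul_rieszPotential_rpow_le [Nontrivial E] (μ : Measure E)
    [μ.IsAddHaarMeasure] {a q : ℝ} (ha : 0 < a) (hq : 1 < q) (haq : a * q < finrank ℝ E) :
    ∃ C : ℝ≥0, ∀ v : E → ℝ≥0∞, Measurable v →
      (∀ t, μ {x | t < v x} ≤ t ^ (-(finrank ℝ E / a))) → ∀ g, Measurable g →
        ∫⁻ x, (v x * rieszPotential μ a g x) ^ q ∂μ ≤ C * ∫⁻ x, g x ^ q ∂μ := by
  obtain ⟨p₀, hp₀, hp₀q⟩ := exists_between hq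
  obtain ⟨p₁, hqp₁, hp₁⟩ := exists_between ((lt_div_iff₀' ha).2 haq)
  rw [lt_div_iff₀' ha] at hp₁
  obtain ⟨C₀, hC₀⟩ := exists_meas_lt_mul_rieszPotential_le μ ha hp₀
    ((mul_lt_mul_of_pos_left hp₀q ha).trans haq)
  obtain ⟨C₁, hC₁⟩ := exists_meas_lt_mul_rieszPotential_le μ ha (hq.trans hqp₁) hp₁
  obtain ⟨C, hC⟩ := exists_lintegral_rpow_le_of_weakType μ μ (zero_lt_one.trans hp₀) hp₀q hqp₁ C₀ C₁
  refine ⟨C, fun v hvm hv g hg => hC (fun g x => v x * rieszPotential μ a g x) ?_ (hC₀ v hv)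
    (hC₁ v hv) g hg (hvm.mul (measurable_rieszPotential μ a hg))⟩
  intro g h hg _ x
  rw [rieszPotential_add μ a hg, mul_add]

end WeakTypeRiesz

section Laplacian

open Module Filter Topology

lemma integral_smul_fderiv_eq_neg_of_hasCompactSupport {E F : Type*} [NormedAddCommGroup E]
    [NormedSpace ℝ E] [FiniteDimensional ℝ E] [MeasurableSpace E] [BorelSpace E]
    [NormedAddCommGroup F] [NormedSpace ℝ F] (μ : Measure E) [μ.IsAddHaarMeasure] {φ : E → ℝ}
    {g : E → F} (hφ : ContDiff ℝ 1 φ) (hg : ContDiff ℝ 1 g) (hgc : HasCompactSupport g) (v : E) :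
    ∫ x, φ x • fderiv ℝ g x v ∂μ = -∫ x, fderiv ℝ φ x v • g x ∂μ := by
  have hφ' : Continuous fun x => fderiv ℝ φ x v :=
    (hφ.continuous_fderiv one_ne_zero).clm_apply continuous_const
  have hg' : Continuous fun x => fderiv ℝ g x v :=
    (hg.continuous_fderiv one_ne_zero).clm_apply continuous_const
  refine integral_smul_fderiv_eq_neg_fderiv_smul_of_integrable ?_ ?_ ?_
    (fun x _ => hφ.differentiable one_ne_zero x) (fun x _ => hg.differentiable one_ne_zero x)
  · exact (hφ'.smul hg.continuous).integrable_of_hasCompactSupport hgc.smul_left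
  · exact (hφ.continuous.smul hg').integrable_of_hasCompactSupport
      (hgc.fderiv_apply ℝ v).smul_left
  · exact (hφ.continuous.smul hg.continuous).integrable_of_hasCompactSupport hgc.smul_left

variable {N : ℕ}

local notation "𝔼" => EuclideanSpace ℝ (Fin N)

lemma contDiff_pderivE (i : Fin N) {f : 𝔼 → ℂ} (hf : ContDiff ℝ (⊤ : ℕ∞) f) :
    ContDiff ℝ (⊤ : ℕ∞) (pderivE i f) :=
  (hf.fderiv_right le_rfl).clm_apply contDiff_const

lemma hasCompactSupport_pderivE (i : Fin N) {f : 𝔼 → ℂ} (hf : HasCompactSupport f) :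
    HasCompactSupport (pderivE i f) :=
  hf.fderiv_apply ℝ _

lemma negLapPow_one (f : 𝔼 → ℂ) :
    negLapPow 1 f = fun x => -∑ i : Fin N, pderivE i (pderivE i f) x := rfl

lemma contDiff_negLapPow_one {f : 𝔼 → ℂ} (hf : ContDiff ℝ (⊤ : ℕ∞) f) :
    ContDiff ℝ (⊤ : ℕ∞) (negLapPow 1 f) := by
  rw [negLapPow_one]
  exact (ContDiff.sum fun i _ => contDiff_pderivE i (contDiff_pderivE i hf)).neg

lemma hasCompactSupport_negLapPow_one {f : 𝔼 → ℂ} (hf : HasCompactSupport f) :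
    HasCompactSupport (negLapPow 1 f) := by
  rw [negLapPow_one]
  refine HasCompactSupport.of_support_subset_isCompact hf fun x hx => ?_
  by_contra h
  refine hx ?_
  have hi : ∀ i : Fin N, pderivE i (pderivE i f) x = 0 := fun i => by
    have h1 : tsupport (pderivE i f) ⊆ tsupport f :=  tsupport_fderiv_apply_subset ℝ _
    exact image_eq_zero_of_notMem_tsupport
      fun h' => h (h1 (tsupport_fderiv_apply_subset ℝ _ h'))
  simp [hi]

lemma continuous_negLapPow (k : ℕ) {f : 𝔼 → ℂ} (hf : ContDiff ℝ (⊤ : ℕ∞) f) :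
    Continuous (negLapPow k f) := by
  induction k generalizing f with
  | zero => exact hf.continuous
  | succ k ih => exact ih (contDiff_negLapPow_one hf)

lemma hasFDerivAt_add_norm_sub_sq_rpow {E : Type*} [NormedAddCommGroup E] [InnerProductSpace ℝ E]
    {δ : ℝ} (hδ : 0 < δ) (s : ℝ) (x y : E) :
    HasFDerivAt (fun y => (δ + ‖y - x‖ ^ 2) ^ s)
      ((s * (δ + ‖y - x‖ ^ 2) ^ (s - 1)) • (2 • innerSL ℝ (y - x))) y := by
  have h := (((hasFDerivAt_id (𝕜 := ℝ) y).sub_const x).norm_sq.const_add δ)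
  exact h.rpow_const (p := s) (Or.inl (by simp only [id]; positivity))

lemma contDiff_add_norm_sub_sq_rpow {E : Type*} [NormedAddCommGroup E] [InnerProductSpace ℝ E]
    {δ : ℝ} (hδ : 0 < δ) (s : ℝ) (x : E) {n : WithTop ℕ∞} :
    ContDiff ℝ n fun y => (δ + ‖y - x‖ ^ 2) ^ s :=
  (contDiff_const.add ((contDiff_id.sub contDiff_const).norm_sq ℝ)).rpow_const_of_ne
    fun y => by simp only [id]; positivity

lemma fderiv_add_norm_sub_sq_rpow_single {δ : ℝ} (hδ : 0 < δ) (s : ℝ) (x y : 𝔼) (i : Fin N) :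
    fderiv ℝ (fun y => (δ + ‖y - x‖ ^ 2) ^ s) y (EuclideanSpace.single i 1) =
      2 * s * (δ + ‖y - x‖ ^ 2) ^ (s - 1) * (y - x) i := by
  rw [(hasFDerivAt_add_norm_sub_sq_rpow hδ s x y).fderiv]
  simp [EuclideanSpace.inner_single_right]
  ring

lemma fderiv_fderiv_add_norm_sub_sq_rpow_single {δ : ℝ} (hδ : 0 < δ) (s : ℝ) (x y : 𝔼)
    (i : Fin N) :
    fderiv ℝ (fun y => fderiv ℝ (fun y => (δ + ‖y - x‖ ^ 2) ^ s) y (EuclideanSpace.single i 1)) y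
      (EuclideanSpace.single i 1) =
      2 * s * ((δ + ‖y - x‖ ^ 2) ^ (s - 1) +
        2 * (s - 1) * (δ + ‖y - x‖ ^ 2) ^ (s - 2) * (y - x) i ^ 2) := by
  simp_rw [fderiv_add_norm_sub_sq_rpow_single hδ s x]
  have h1 : HasFDerivAt (fun y : 𝔼 => (y - x) i) (EuclideanSpace.proj (𝕜 := ℝ) i) y := by
    simpa using (EuclideanSpace.proj (𝕜 := ℝ) i).hasFDerivAt.sub_const (x i)
  have h2 := ((hasFDerivAt_add_norm_sub_sq_rpow hδ (s - 1) x y).const_mul (2 * s)).mul h1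
  refine (DFunLike.congr_fun h2.fderiv _).trans ?_
  simp [EuclideanSpace.inner_single_right]
  ring_nf

/-- The regularised fundamental solution `(δ + |y - x|²)^((2 - N) / 2)` has Laplacian
`-N (N - 2) δ (δ + |y - x|²)^(-(N + 2) / 2)`. -/
lemma sum_fderiv_fderiv_add_norm_sub_sq_rpow {δ : ℝ} (hδ : 0 < δ) (x y : 𝔼) :
    ∑ i : Fin N, fderiv ℝ (fun y => fderiv ℝ (fun y => (δ + ‖y - x‖ ^ 2) ^ ((2 - N : ℝ) / 2)) y
      (EuclideanSpace.single i 1)) y (EuclideanSpace.single i 1) =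
      -(N * (N - 2) * (δ * (δ + ‖y - x‖ ^ 2) ^ (-(N + 2 : ℝ) / 2))) := by
  simp_rw [fderiv_fderiv_add_norm_sub_sq_rpow_single hδ]
  have hρ : 0 < δ + ‖y - x‖ ^ 2 := by positivity
  have hsq : ∑ i : Fin N, (y - x) i ^ 2 = ‖y - x‖ ^ 2 := by
    rw [EuclideanSpace.norm_sq_eq]; simp
  rw [← Finset.mul_sum, Finset.sum_add_distrib, ← Finset.mul_sum, hsq, Finset.sum_const,
    Finset.card_univ, Fintype.card_fin, nsmul_eq_mul]
  have e1 : (2 - N : ℝ) / 2 - 2 = -(N + 2 : ℝ) / 2 := by ring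
  have e2 : (δ + ‖y - x‖ ^ 2) ^ ((2 - N : ℝ) / 2 - 1) =
      (δ + ‖y - x‖ ^ 2) ^ (-(N + 2 : ℝ) / 2) * (δ + ‖y - x‖ ^ 2) := by
    nth_rw 3 [← Real.rpow_one (δ + ‖y - x‖ ^ 2)]
    rw [← Real.rpow_add hρ]
    congr 1
    ring
  rw [e1, e2]
  ring

lemma integral_smul_negLapPow_one {φ : 𝔼 → ℝ} (hφ : ContDiff ℝ 2 φ) {f : 𝔼 → ℂ}
    (hf : ContDiff ℝ (⊤ : ℕ∞) f) (hfc : HasCompactSupport f) :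
    ∫ y, φ y • negLapPow 1 f y = ∫ y, (-∑ i : Fin N,
      fderiv ℝ (fun y => fderiv ℝ φ y (EuclideanSpace.single i 1)) y
        (EuclideanSpace.single i 1)) • f y := by
  have hφ' : ∀ i : Fin N, ContDiff ℝ 1 fun y => fderiv ℝ φ y (EuclideanSpace.single i 1) :=
    fun i => (hφ.fderiv_right (by norm_num)).clm_apply contDiff_const
  have hf1 : ∀ i : Fin N, ContDiff ℝ (⊤ : ℕ∞) (pderivE i f) := fun i => contDiff_pderivE i hf
  have hone : (1 : WithTop ℕ∞) ≤ (⊤ : ℕ∞) := by exact_mod_cast le_top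
  have hf2 : ∀ i : Fin N, Continuous (pderivE i (pderivE i f)) := fun i =>
    (contDiff_pderivE i (hf1 i)).continuous
  simp only [negLapPow_one, smul_neg, neg_smul, integral_neg, Finset.smul_sum, Finset.sum_smul]
  rw [integral_finsetSum _ fun i _ => ?_, integral_finsetSum _ fun i _ => ?_]
  · refine congrArg _ (Finset.sum_congr rfl fun i _ => ?_)
    have h1 := integral_smul_fderiv_eq_neg_of_hasCompactSupport volume (hφ.of_le (by norm_num))
      ((hf1 i).of_le hone) (hasCompactSupport_pderivE i hfc) (EuclideanSpace.single i 1)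
    have h2 := integral_smul_fderiv_eq_neg_of_hasCompactSupport volume (hφ' i)
      (hf.of_le hone) hfc (EuclideanSpace.single i 1)
    exact h1.trans (neg_eq_iff_eq_neg.2 h2)
  · exact ((((hφ' i).continuous_fderiv one_ne_zero).clm_apply continuous_const).smul
      hf.continuous).integrable_of_hasCompactSupport hfc.smul_left
  · exact (hφ.continuous.smul (hf2 i)).integrable_of_hasCompactSupport
      (hasCompactSupport_pderivE i (hasCompactSupport_pderivE i hfc)).smul_left

lemma integrable_one_add_norm_sq_rpow :
    Integrable (fun w : 𝔼 => (1 + ‖w‖ ^ 2) ^ (-(N + 2 : ℝ) / 2)) :=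
  integrable_rpow_neg_one_add_norm_sq (by simp)

lemma tendsto_norm_pow_mul_one_add_norm_sq_rpow :
    Tendsto (fun w : 𝔼 => ‖w‖ ^ N * (1 + ‖w‖ ^ 2) ^ (-(N + 2 : ℝ) / 2)) (Bornology.cobounded 𝔼)
      (𝓝 0) := by
  have h : Tendsto (fun w : 𝔼 => ‖w‖ ^ (-2 : ℝ)) (Bornology.cobounded 𝔼) (𝓝 0) :=
    (tendsto_rpow_neg_atTop two_pos).comp tendsto_norm_cobounded_atTop
  refine squeeze_zero' (Eventually.of_forall fun w => by positivity) ?_ h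
  filter_upwards [tendsto_norm_cobounded_atTop.eventually_gt_atTop 0] with w hw
  calc ‖w‖ ^ N * (1 + ‖w‖ ^ 2) ^ (-(N + 2 : ℝ) / 2)
      ≤ ‖w‖ ^ N * (‖w‖ ^ 2) ^ (-(N + 2 : ℝ) / 2) := by
        refine mul_le_mul_of_nonneg_left ?_ (by positivity)
        refine Real.rpow_le_rpow_of_nonpos (by positivity) (by linarith) ?_
        have : (0 : ℝ) ≤ N := N.cast_nonneg
        linarith
    _ = ‖w‖ ^ (-2 : ℝ) := by
        rw [← Real.rpow_natCast, ← Real.rpow_natCast, ← Real.rpow_mul hw.le, ← Real.rpow_add hw]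
        congr 1
        push_cast
        ring

lemma integral_one_add_norm_sq_rpow_pos :
    0 < ∫ w : 𝔼, (1 + ‖w‖ ^ 2) ^ (-(N + 2 : ℝ) / 2) := by
  rw [integral_pos_iff_support_of_nonneg (fun w => by positivity) integrable_one_add_norm_sq_rpow,
    Function.support_eq_univ fun w => by positivity]
  exact Measure.measure_univ_pos.2 (NeZero.ne _)

/-- Up to normalisation, the Laplacians of the regularised fundamental solutions form an
approximate identity. -/
lemma tendsto_integral_add_norm_sub_sq_rpow_smul {f : 𝔼 → ℂ} (hf : Continuous f)
    (hfc : HasCompactSupport f) (x : 𝔼) :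
    Tendsto (fun c : ℝ => ∫ y, (c ^ (-2 : ℝ) * (c ^ (-2 : ℝ) + ‖y - x‖ ^ 2) ^ (-(N + 2 : ℝ) / 2)) •
      f y) atTop (𝓝 ((∫ w : 𝔼, (1 + ‖w‖ ^ 2) ^ (-(N + 2 : ℝ) / 2)) • f x)) := by
  set κ := ∫ w : 𝔼, (1 + ‖w‖ ^ 2) ^ (-(N + 2 : ℝ) / 2) with hκ
  have hκ0 : 0 < κ := integral_one_add_norm_sq_rpow_pos
  have h := tendsto_integral_comp_smul_smul_of_integrable' (μ := (volume : Measure 𝔼))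
    (φ := fun w => κ⁻¹ * (1 + ‖w‖ ^ 2) ^ (-(N + 2 : ℝ) / 2)) (fun w => by positivity)
    (by rw [integral_const_mul, inv_mul_cancel₀ hκ0.ne'])
    (by
      have := (tendsto_norm_pow_mul_one_add_norm_sq_rpow (N := N)).const_mul κ⁻¹
      rw [mul_zero] at this
      refine this.congr fun w => ?_
      rw [finrank_euclideanSpace_fin]
      ring)
    (hf.integrable_of_hasCompactSupport hfc) (x₀ := x) hf.continuousAt
  refine (h.const_smul κ).congr' ?_
  filter_upwards [eventually_gt_atTop 0] with c hc
  rw [← integral_smul]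
  refine integral_congr_ae (Eventually.of_forall fun y => ?_)
  simp only [smul_smul]
  congr 1
  have e1 : 1 + ‖c • (x - y)‖ ^ 2 = c ^ (2 : ℝ) * (c ^ (-2 : ℝ) + ‖y - x‖ ^ 2) := by
    rw [norm_smul, norm_sub_rev, mul_add, ← Real.rpow_add hc]
    simp [mul_pow]
  rw [e1, Real.mul_rpow (by positivity) (by positivity), ← Real.rpow_mul hc.le,
    finrank_euclideanSpace_fin, ← Real.rpow_natCast]
  have e2 : c ^ (-2 : ℝ) = c ^ (N : ℝ) * c ^ (2 * (-(N + 2 : ℝ) / 2)) := by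
    rw [← Real.rpow_add hc]
    congr 1
    ring
  nth_rw 2 [e2]
  field_simp

lemma enorm_add_norm_sub_sq_rpow_le {E : Type*} [NormedAddCommGroup E] {δ : ℝ} (hδ : 0 < δ)
    {s : ℝ} (hs : s < 0) (x y : E) :
    ‖(δ + ‖y - x‖ ^ 2) ^ (s / 2)‖ₑ ≤ edist x y ^ s := by
  rcases eq_or_ne y x with rfl | hxy
  · simp [hs]
  have hpos : 0 < ‖y - x‖ := norm_pos_iff.2 (sub_ne_zero.2 hxy)
  rw [edist_comm, edist_dist, dist_eq_norm, ENNReal.ofReal_rpow_of_pos hpos, Real.enorm_eq_ofReal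
    (by positivity)]
  refine ENNReal.ofReal_le_ofReal ?_
  calc (δ + ‖y - x‖ ^ 2) ^ (s / 2) ≤ (‖y - x‖ ^ 2) ^ (s / 2) :=
        Real.rpow_le_rpow_of_nonpos (by positivity) (by linarith) (by linarith)
    _ = ‖y - x‖ ^ s := by
        rw [← Real.rpow_natCast, ← Real.rpow_mul hpos.le]
        congr 1
        push_cast
        ring

lemma exists_enorm_le_rieszPotential_negLapPow_one (hN : 2 < N) :
    ∃ C : ℝ≥0, ∀ f : 𝔼 → ℂ, ContDiff ℝ (⊤ : ℕ∞) f → HasCompactSupport f → ∀ x,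
      ‖f x‖ₑ ≤ C * rieszPotential volume 2 (fun y => ‖negLapPow 1 f y‖ₑ) x := by
  have hN' : (2 : ℝ) < N := by exact_mod_cast hN
  set κ := ∫ w : 𝔼, (1 + ‖w‖ ^ 2) ^ (-(N + 2 : ℝ) / 2) with hκ
  have hκ0 : 0 < κ := integral_one_add_norm_sq_rpow_pos
  set K : ℝ := N * (N - 2) * κ with hK
  have hK0 : 0 < K := mul_pos (mul_pos (by linarith) (by linarith)) hκ0
  refine ⟨(K⁻¹).toNNReal, fun f hf hfc x => ?_⟩
  have hlim := ((tendsto_integral_add_norm_sub_sq_rpow_smul hf.continuous hfc x).const_smul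
    (N * (N - 2) : ℝ)).enorm
  rw [smul_smul, ← hκ, ← hK] at hlim
  have hle : ‖K • f x‖ₑ ≤ rieszPotential volume 2 (fun y => ‖negLapPow 1 f y‖ₑ) x := by
    refine le_of_tendsto hlim ?_
    filter_upwards [eventually_gt_atTop 0] with c hc
    have hδ : 0 < c ^ (-2 : ℝ) := by positivity
    have h := integral_smul_negLapPow_one
      (contDiff_add_norm_sub_sq_rpow hδ ((2 - N : ℝ) / 2) x) hf hfc
    simp only [sum_fderiv_fderiv_add_norm_sub_sq_rpow hδ, neg_neg, mul_smul _ (_ * _ : ℝ)] at h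
    rw [integral_smul] at h
    rw [← h]
    refine (enorm_integral_le_lintegral_enorm _).trans (lintegral_mono fun y => ?_)
    rw [enorm_smul, finrank_euclideanSpace_fin]
    exact mul_le_mul' (enorm_add_norm_sub_sq_rpow_le hδ (by linarith) x y) le_rfl
  calc ‖f x‖ₑ = ((K⁻¹).toNNReal : ℝ≥0∞) * ‖K • f x‖ₑ := by
        rw [enorm_smul, ← mul_assoc, Real.enorm_eq_ofReal hK0.le, ← ENNReal.ofReal,
          ← ENNReal.ofReal_mul (by positivity), inv_mul_cancel₀ hK0.ne', ENNReal.ofReal_one,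
          one_mul]
    _ ≤ _ := by gcongr

lemma exists_enorm_le_rieszPotential_negLapPow {k : ℕ} (hk : 1 ≤ k) (hN : 2 * k < N) :
    ∃ C : ℝ≥0, ∀ f : 𝔼 → ℂ, ContDiff ℝ (⊤ : ℕ∞) f → HasCompactSupport f → ∀ x,
      ‖f x‖ₑ ≤ C * rieszPotential volume (2 * k) (fun y => ‖negLapPow k f y‖ₑ) x := by
  have : Nontrivial 𝔼 := Module.nontrivial_of_finrank_pos (R := ℝ)
    (by rw [finrank_euclideanSpace_fin]; omega)
  induction k, hk using Nat.le_induction with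
  | base => simpa using exists_enorm_le_rieszPotential_negLapPow_one (by omega)
  | succ k hk ih =>
    obtain ⟨C₁, hC₁⟩ := exists_enorm_le_rieszPotential_negLapPow_one (N := N) (by omega)
    obtain ⟨C₂, hC₂⟩ := ih (by omega)
    have hk0 : (0 : ℝ) < 2 * k := by positivity
    have hkN : (2 : ℝ) + 2 * k < finrank ℝ 𝔼 := by
      rw [finrank_euclideanSpace_fin]
      exact_mod_cast (by omega : 2 + 2 * k < N)
    obtain ⟨C₃, hC₃⟩ := lintegral_edist_rpow_mul_edist_rpow_le (volume : Measure 𝔼) two_pos hk0 hkN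
    refine ⟨C₁ * (C₂ * C₃), fun f hf hfc x => ?_⟩
    set g : 𝔼 → ℝ≥0∞ := fun y => ‖negLapPow (k + 1) f y‖ₑ with hg
    have hgm : Measurable g := (continuous_negLapPow (k + 1) hf).measurable.enorm
    have h1 : ∀ z, ‖negLapPow 1 f z‖ₑ ≤ C₂ * rieszPotential volume (2 * k) g z :=
      hC₂ _ (contDiff_negLapPow_one hf) (hasCompactSupport_negLapPow_one hfc)
    refine (hC₁ f hf hfc x).trans ?_
    push_cast
    rw [mul_assoc (C₁ : ℝ≥0∞)]
    refine mul_le_mul' le_rfl ?_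
    set d : ℝ := (finrank ℝ 𝔼 : ℝ)
    calc rieszPotential volume 2 (fun y => ‖negLapPow 1 f y‖ₑ) x
        ≤ ∫⁻ z, edist x z ^ (2 - d) * (C₂ * rieszPotential volume (2 * k) g z) :=
          lintegral_mono fun z => mul_le_mul' le_rfl (h1 z)
      _ = C₂ * ∫⁻ z, ∫⁻ y, edist x z ^ (2 - d) * edist z y ^ (2 * k - d) * g y := by
          simp_rw [mul_left_comm _ (C₂ : ℝ≥0∞)]
          rw [lintegral_const_mul (C₂ : ℝ≥0∞) (f := fun z =>
            edist x z ^ (2 - d) * rieszPotential volume (2 * k) g z)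
            (Measurable.mul (by fun_prop) (measurable_rieszPotential _ _ hgm))]
          simp_rw [rieszPotential, mul_assoc]
          congr 2 with z
          exact (lintegral_const_mul _ (by fun_prop)).symm
      _ = C₂ * ∫⁻ y, (∫⁻ z, edist x z ^ (2 - d) * edist z y ^ (2 * k - d)) * g y := by
          rw [lintegral_lintegral_swap (by unfold Function.uncurry; fun_prop)]
          congr 2 with y
          exact lintegral_mul_const _ (by fun_prop)
      _ ≤ C₂ * ∫⁻ y, C₃ * (edist x y ^ (2 * (k + 1 : ℝ) - d) * g y) := by
          refine mul_le_mul' le_rfl (lintegral_mono fun y => ?_)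
          rw [← mul_assoc]
          refine mul_le_mul' ((hC₃ x y).trans_eq ?_) le_rfl
          congr 2
          ring
      _ = C₂ * C₃ * rieszPotential volume (2 * (k + 1 : ℝ)) g x := by
          rw [lintegral_const_mul _ (by fun_prop), mul_assoc]
          rfl

end Laplacian

lemma meas_lt_enorm_le_of_weakLpNorm {α : Type*} [MeasurableSpace α] (μ : Measure α) {r : ℝ}
    (hr : 0 < r) (g : α → ℝ) {γ : ℝ} (hγ : 0 < γ) :
    μ {x | ENNReal.ofReal γ < ‖g x‖ₑ} ≤ (ENNReal.ofReal γ / weakLpNorm μ r g) ^ (-r) := by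
  have hset : {x | ENNReal.ofReal γ < ‖g x‖ₑ} = {x | γ < |g x|} := by
    ext x
    change ENNReal.ofReal γ < ‖g x‖ₑ ↔ γ < |g x|
    rw [Real.enorm_eq_ofReal_abs, ENNReal.ofReal_lt_ofReal_iff_of_nonneg hγ.le]
  have hγ0 : ENNReal.ofReal γ ≠ 0 := by simpa using hγ
  have h : ENNReal.ofReal γ * μ {x | γ < |g x|} ^ (1 / r) ≤ weakLpNorm μ r g :=
    le_iSup₂ (f := fun (γ : ℝ) (_ : 0 < γ) => ENNReal.ofReal γ * μ {x | γ < |g x|} ^ (1 / r)) γ hγ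
  rw [hset, ENNReal.rpow_neg, ← ENNReal.inv_rpow,
    ENNReal.inv_div (Or.inr ENNReal.ofReal_ne_top) (Or.inr hγ0)]
  calc μ {x | γ < |g x|} = (μ {x | γ < |g x|} ^ (1 / r)) ^ r := by
        rw [← ENNReal.rpow_mul, one_div_mul_cancel hr.ne', ENNReal.rpow_one]
    _ ≤ _ := by
        refine ENNReal.rpow_le_rpow ?_ hr.le
        rwa [ENNReal.le_div_iff_mul_le (Or.inl hγ0) (Or.inl ENNReal.ofReal_ne_top), mul_comm]

lemma meas_lt_enorm_div_weakLpNorm_le {α : Type*} [MeasurableSpace α] (μ : Measure α) {r : ℝ}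
    (hr : 0 < r) (g : α → ℝ) (h0 : weakLpNorm μ r g ≠ 0) (htop : weakLpNorm μ r g ≠ ∞)
    (t : ℝ≥0∞) : μ {x | t < ‖g x‖ₑ / weakLpNorm μ r g} ≤ t ^ (-r) := by
  set A := weakLpNorm μ r g with hA
  rcases eq_or_ne t 0 with rfl | ht0
  · simp [ENNReal.zero_rpow_of_neg (neg_lt_zero.2 hr)]
  rcases eq_or_ne t ∞ with rfl | ht
  · simp
  have htA : t * A ≠ ∞ := ENNReal.mul_ne_top ht htop
  have hpos : 0 < (t * A).toReal := ENNReal.toReal_pos (mul_ne_zero ht0 h0) htA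
  have h := meas_lt_enorm_le_of_weakLpNorm μ hr g hpos
  rw [ENNReal.ofReal_toReal htA, ← hA, ENNReal.mul_div_cancel_right h0 htop] at h
  refine (measure_mono fun x hx => ?_).trans h
  exact (ENNReal.lt_div_iff_mul_lt (Or.inl h0) (Or.inl htop)).1 hx

lemma ae_eq_zero_of_weakLpNorm_eq_zero {α : Type*} [MeasurableSpace α] {μ : Measure α} {r : ℝ}
    (hr : 0 < r) {g : α → ℝ} (h0 : weakLpNorm μ r g = 0) : g =ᵐ[μ] 0 := by
  have h : ∀ n : ℕ, ∀ᵐ x ∂μ, ‖g x‖ₑ ≤ ENNReal.ofReal (1 / (n + 1 : ℝ)) := fun n => by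
    have hn : (0 : ℝ) < 1 / (n + 1 : ℝ) := by positivity
    have h' := meas_lt_enorm_le_of_weakLpNorm μ hr g hn
    rw [h0, ENNReal.div_zero (by simpa using hn), ENNReal.top_rpow_of_neg (by linarith)] at h'
    rw [ae_iff]
    simpa using h'
  filter_upwards [ae_all_iff.2 h] with x hx
  have : Filter.Tendsto (fun n : ℕ => ENNReal.ofReal (1 / (n + 1 : ℝ))) Filter.atTop
      (nhds (ENNReal.ofReal 0)) := ENNReal.tendsto_ofReal tendsto_one_div_add_atTop_nhds_zero_nat
  simpa using ge_of_tendsto' this hx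

/-- for `N > 2m`, `1 < q < N/(2m)` and `V` in weak `L^{N/2m}`,
`‖V f‖_{L^q} ≤ C ‖V‖_{L^{N/2m,∞}} ‖(-Δ)^m f‖_{L^q}` for every test function `f`. -/
theorem stmt_14 (m N : ℕ) (hm : 1 ≤ m) (hN : 2 * m < N)
    (q : ℝ) (hq1 : 1 < q) (hq2 : q < (N : ℝ) / (2 * m)) :
    ∃ C : ℝ, 0 < C ∧
      ∀ V : EuclideanSpace ℝ (Fin N) → ℝ, Measurable V →
        weakLpNorm volume ((N : ℝ) / (2 * m)) V < ⊤ →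
        ∀ f : EuclideanSpace ℝ (Fin N) → ℂ,
          ContDiff ℝ (⊤ : ℕ∞) f → HasCompactSupport f →
          eLpNorm (fun x => (V x : ℂ) * f x) (ENNReal.ofReal q) volume ≤
            ENNReal.ofReal C * weakLpNorm volume ((N : ℝ) / (2 * m)) V *
              eLpNorm (negLapPow m f) (ENNReal.ofReal q) volume := by
  have hq0 : 0 < q := by linarith
  have hm0 : (0 : ℝ) < 2 * m := by positivity
  have hr : 0 < (N : ℝ) / (2 * m) := hq0.trans hq2
  have : Nontrivial (EuclideanSpace ℝ (Fin N)) := Module.nontrivial_of_finrank_pos (R := ℝ)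
    (by rw [finrank_euclideanSpace_fin]; omega)
  obtain ⟨C₁, hC₁⟩ := exists_enorm_le_rieszPotential_negLapPow hm hN
  obtain ⟨C₂, hC₂⟩ := exists_lintegral_mul_rieszPotential_rpow_le
    (volume : Measure (EuclideanSpace ℝ (Fin N))) hm0 hq1
    (by rwa [finrank_euclideanSpace_fin, ← lt_div_iff₀' hm0])
  rw [finrank_euclideanSpace_fin] at hC₂
  refine ⟨C₁ * C₂ ^ (1 / q) + 1, by positivity, fun V hV hVt f hf hfc => ?_⟩
  set A := weakLpNorm volume ((N : ℝ) / (2 * m)) V with hA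
  rcases eq_or_ne A 0 with hA0 | hA0
  · have hV0 := ae_eq_zero_of_weakLpNorm_eq_zero hr hA0
    have : (fun x => (V x : ℂ) * f x) =ᵐ[volume] 0 := by
      filter_upwards [hV0] with x hx
      simp [hx]
    simp [eLpNorm_congr_ae this]
  have hp0 : ENNReal.ofReal q ≠ 0 := by simpa using hq0
  rw [eLpNorm_eq_lintegral_rpow_enorm_toReal hp0 ENNReal.ofReal_ne_top,
    eLpNorm_eq_lintegral_rpow_enorm_toReal hp0 ENNReal.ofReal_ne_top, ENNReal.toReal_ofReal hq0.le]
  set I := rieszPotential volume (2 * m) fun y => ‖negLapPow m f y‖ₑ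
  have hg : Measurable fun y => ‖negLapPow m f y‖ₑ := (continuous_negLapPow m hf).measurable.enorm
  have hv : Measurable fun x => ‖V x‖ₑ / A := hV.enorm.div_const A
  have hVI : Measurable fun x => (‖V x‖ₑ / A * I x) ^ q :=
    (hv.mul (measurable_rieszPotential _ _ hg)).pow_const q
  have hmain := hC₂ (fun x => ‖V x‖ₑ / A) hv
    (meas_lt_enorm_div_weakLpNorm_le volume hr V hA0 hVt.ne) _ hg
  have hpt : ∀ x, ‖(V x : ℂ) * f x‖ₑ ≤ C₁ * A * (‖V x‖ₑ / A * I x) := fun x => by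
    have hVx : ‖(V x : ℂ)‖ₑ = A * (‖V x‖ₑ / A) := by
      rw [ENNReal.mul_div_cancel hA0 hVt.ne, ← ofReal_norm, ← ofReal_norm, Complex.norm_real]
    calc ‖(V x : ℂ) * f x‖ₑ ≤ A * (‖V x‖ₑ / A) * (C₁ * I x) := by
          rw [enorm_mul, hVx]
          exact mul_le_mul' le_rfl (hC₁ f hf hfc x)
      _ = _ := by ring
  have hC : (C₁ : ℝ≥0∞) * (C₂ : ℝ≥0∞) ^ (1 / q) ≤ ENNReal.ofReal (C₁ * C₂ ^ (1 / q) + 1) := by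
    rw [← ENNReal.coe_rpow_of_nonneg _ (by positivity), ← ENNReal.coe_mul,
      ← ENNReal.ofReal_coe_nnreal]
    refine ENNReal.ofReal_le_ofReal ?_
    push_cast
    linarith
  calc (∫⁻ x, ‖(V x : ℂ) * f x‖ₑ ^ q) ^ (1 / q)
      ≤ (∫⁻ x, (C₁ * A) ^ q * (‖V x‖ₑ / A * I x) ^ q) ^ (1 / q) := by
        refine ENNReal.rpow_le_rpow (lintegral_mono fun x => ?_) (by positivity)
        rw [← ENNReal.mul_rpow_of_nonneg _ _ hq0.le]
        exact ENNReal.rpow_le_rpow (hpt x) hq0.le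
    _ = (C₁ * A) * (∫⁻ x, (‖V x‖ₑ / A * I x) ^ q) ^ (1 / q) := by
        rw [lintegral_const_mul ((C₁ * A) ^ q) hVI,
          ENNReal.mul_rpow_of_nonneg _ _ (by positivity), ← ENNReal.rpow_mul,
          mul_one_div_cancel hq0.ne', ENNReal.rpow_one]
    _ ≤ (C₁ * A) * (C₂ * ∫⁻ x, ‖negLapPow m f x‖ₑ ^ q) ^ (1 / q) :=
        mul_le_mul' le_rfl (ENNReal.rpow_le_rpow hmain (by positivity))
    _ = (C₁ * C₂ ^ (1 / q)) * A * (∫⁻ x, ‖negLapPow m f x‖ₑ ^ q) ^ (1 / q) := by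
        rw [ENNReal.mul_rpow_of_nonneg _ _ (by positivity)]
        ring
    _ ≤ _ := mul_le_mul' (mul_le_mul' hC le_rfl) le_rfl
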